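/- arXiv:1408.2805 — 2 statements merged into one kernel-verified Lean document; each statement's English description precedes it below -/
import Mathlib

section
/- Let X be a nonempty compact convex subset of ℝⁿ, let μ : X → ℝ be continuous and convex on X, let d = min μ(X), let p : ℝⁿ → ℝ be concave and continuous, and define f : [d, ∞) → ℝ by f(R) = max { p(x) : x ∈ X, μ(x) ≤ R }. Then f is continuous on [d, ∞). -/
/-- The value function of a concave maximization problem is concave in the level of the
convex constraint. -/
theorem concaveOn_valueFunction {E : Type*} [AddCommGroup E] [Module ℝ E] {X : Set E}
    {μ p : E → ℝ} {f : ℝ → ℝ} {d : ℝ} (hμ : ConvexOn ℝ X μ) (hp : ConcaveOn ℝ X p)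
    (hf : ∀ R, d ≤ R → IsGreatest (p '' {x | x ∈ X ∧ μ x ≤ R}) (f R)) :
    ConcaveOn ℝ (Set.Ici d) f := by
  refine ⟨convex_Ici d, fun R hR S hS a b ha hb hab => ?_⟩
  obtain ⟨x, ⟨hxX, hxR⟩, hx⟩ := (hf R hR).1
  obtain ⟨y, ⟨hyX, hyS⟩, hy⟩ := (hf S hS).1
  have hfeas : μ (a • x + b • y) ≤ a • R + b • S :=
    (hμ.2 hxX hyX ha hb hab).trans (by simp only [smul_eq_mul]; gcongr)
  have hle := (hf _ (convex_Ici d hR hS ha hb hab)).2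
    (Set.mem_image_of_mem p ⟨hμ.1 hxX hyX ha hb hab, hfeas⟩)
  rw [← hx, ← hy]
  exact (hp.2 hxX hyX ha hb hab).trans hle

/-- The value function of a maximization problem over a compact set is right-continuous
in the constraint level at the left endpoint of its domain. -/
theorem continuousWithinAt_valueFunction {E : Type*} [TopologicalSpace E] {X : Set E}
    {μ p : E → ℝ} {f : ℝ → ℝ} {d : ℝ} (hX : IsCompact X) (hμ : ContinuousOn μ X)
    (hp : Continuous p)
    (hf : ∀ R, d ≤ R → IsGreatest (p '' {x | x ∈ X ∧ μ x ≤ R}) (f R)) :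
    ContinuousWithinAt f (Set.Ici d) d := by
  refine tendsto_order.2 ⟨fun a ha => ?_, fun a ha => ?_⟩
  · filter_upwards [self_mem_nhdsWithin] with R hR
    obtain ⟨x, ⟨hxX, hxd⟩, hx⟩ := (hf d le_rfl).1
    exact ha.trans_le (hx ▸ (hf R hR).2 (Set.mem_image_of_mem p ⟨hxX, hxd.trans hR⟩))
  · have hK : IsCompact (X ∩ {x | a ≤ p x}) :=
      hX.inter_right (isClosed_le continuous_const hp)
    rcases (X ∩ {x | a ≤ p x}).eq_empty_or_nonempty with hempty | hne
    · filter_upwards [self_mem_nhdsWithin] with R hR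
      obtain ⟨x, ⟨hxX, -⟩, hx⟩ := (hf R hR).1
      by_contra! h
      exact hempty.subset ⟨hxX, h.trans hx.ge⟩
    · obtain ⟨z, ⟨hzX, hz⟩, hmin⟩ :=
        hK.exists_isMinOn hne (hμ.mono Set.inter_subset_left)
      have hdz : d < μ z := by
        by_contra! h
        exact (((hf d le_rfl).2 (Set.mem_image_of_mem p ⟨hzX, h⟩)).trans_lt ha).not_ge hz
      filter_upwards [self_mem_nhdsWithin, mem_nhdsWithin_of_mem_nhds (Iio_mem_nhds hdz)]
        with R hR hRz
      obtain ⟨x, ⟨hxX, hxR⟩, hx⟩ := (hf R hR).1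
      by_contra! h
      exact (hxR.trans_lt hRz).not_ge (hmin ⟨hxX, h.trans hx.ge⟩)

/-- With `X ⊆ ℝⁿ` nonempty compact convex, `μ` continuous and convex on `X`,
`d = min μ(X)`, `p` concave and continuous, and
`f R = max { p x : x ∈ X, μ x ≤ R }` for `R ≥ d`, the function `f` is continuous on `[d, ∞)`. -/
theorem stmt_0 {n : ℕ} (X : Set (Fin n → ℝ)) (hXne : X.Nonempty)
    (hXc : IsCompact X) (hXconv : Convex ℝ X)
    (μ : (Fin n → ℝ) → ℝ) (hμcont : ContinuousOn μ X) (hμconv : ConvexOn ℝ X μ)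
    (d : ℝ) (hd : IsLeast (μ '' X) d)
    (p : (Fin n → ℝ) → ℝ) (hpcont : Continuous p) (hpconc : ConcaveOn ℝ Set.univ p)
    (f : ℝ → ℝ)
    (hf : ∀ R, d ≤ R → IsGreatest (p '' {x | x ∈ X ∧ μ x ≤ R}) (f R)) :
    ContinuousOn f (Set.Ici d) := by
  have hconc : ConcaveOn ℝ (Set.Ici d) f :=
    concaveOn_valueFunction hμconv (hpconc.subset (Set.subset_univ X) hXconv) hf
  intro R hR
  rcases (Set.mem_Ici.1 hR).eq_or_lt with rfl | hlt
  · exact continuousWithinAt_valueFunction hXc hμcont hpcont hf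
  · have hint : R ∈ interior (Set.Ici d) := by rwa [interior_Ici]
    exact (hconc.continuousOn_interior.continuousAt
      (isOpen_interior.mem_nhds hint)).continuousWithinAt
end

section
/- Let X be a nonempty compact convex subset of ℝⁿ, let μ : X → ℝ be continuous and convex on X, let d = min μ(X), let p : ℝⁿ → ℝ be concave and continuous, and define f : [d, ∞) → ℝ by f(R) = max { p(x) : x ∈ X, μ(x) ≤ R }. Then f is right-continuous at d: for every sequence (Rᵢ) in (d, ∞) with Rᵢ → d, one has f(Rᵢ) → f(d). -/
/-- With the same setup, `f` is right-continuous at `d`: for every sequence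
`(Rᵢ)` in `(d, ∞)` with `Rᵢ → d`, one has `f (Rᵢ) → f d`. -/
theorem stmt_4 {n : ℕ} (X : Set (Fin n → ℝ)) (hXne : X.Nonempty)
    (hXc : IsCompact X) (hXconv : Convex ℝ X)
    (μ : (Fin n → ℝ) → ℝ) (hμcont : ContinuousOn μ X) (hμconv : ConvexOn ℝ X μ)
    (d : ℝ) (hd : IsLeast (μ '' X) d)
    (p : (Fin n → ℝ) → ℝ) (hpcont : Continuous p) (hpconc : ConcaveOn ℝ Set.univ p)
    (f : ℝ → ℝ)
    (hf : ∀ R, d ≤ R → IsGreatest (p '' {x | x ∈ X ∧ μ x ≤ R}) (f R)) :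
    ∀ R : ℕ → ℝ, (∀ i, d < R i) → Filter.Tendsto R Filter.atTop (nhds d) →
      Filter.Tendsto (fun i => f (R i)) Filter.atTop (nhds (f d)) := by
  intro R hR hRlim
  refine tendsto_order.2 ⟨fun a ha => Filter.Eventually.of_forall fun i => ?_, fun b hb => ?_⟩
  · obtain ⟨x, ⟨hxX, hx⟩, hpx⟩ := (hf d le_rfl).1
    exact (ha.trans_eq hpx.symm).trans_le
      ((hf (R i) (hR i).le).2 ⟨x, ⟨hxX, hx.trans (hR i).le⟩, rfl⟩)
  · have hK : IsCompact (X ∩ {x | b ≤ p x}) :=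
      hXc.inter_right (isClosed_le continuous_const hpcont)
    have hsep : ∃ m, d < m ∧ ∀ x ∈ X, b ≤ p x → m ≤ μ x := by
      rcases (X ∩ {x | b ≤ p x}).eq_empty_or_nonempty with he | hne
      · exact ⟨d + 1, lt_add_one d, fun x hx hbx => absurd (he ▸ ⟨hx, hbx⟩) (Set.notMem_empty x)⟩
      · obtain ⟨y, ⟨hyX, hby⟩, hy⟩ :=
          hK.exists_isMinOn hne (hμcont.mono Set.inter_subset_left)
        refine ⟨μ y, lt_of_not_ge fun h => ?_, fun x hx hbx => hy ⟨hx, hbx⟩⟩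
        exact (hb.trans_le hby).not_ge ((hf d le_rfl).2 ⟨y, ⟨hyX, h⟩, rfl⟩)
    obtain ⟨m, hdm, hm⟩ := hsep
    filter_upwards [hRlim.eventually_lt_const hdm] with i hi
    obtain ⟨x, ⟨hxX, hx⟩, hpx⟩ := (hf (R i) (hR i).le).1
    rw [← hpx]
    exact lt_of_not_ge fun h => (hx.trans_lt hi).not_ge (hm x hxX h)
end
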